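/- arXiv:1002.1126 — 2 statements merged into one kernel-verified Lean document; each statement's English description precedes it below -/
import Mathlib

section
/- Let s ≥ 0 and k > 2s + 1 be real numbers. Then there exists a constant C > 0 such that for every positive integer p: Σ_{q=1}^∞ q^{2s} ⟨p − q⟩^{−k} ≤ C p^{2s}. -/
/-- Japanese bracket `⟨y⟩ = (1 + y²)^{1/2}`. -/
noncomputable def jb (y : ℝ) : ℝ := Real.sqrt (1 + y ^ 2)

lemma jb_pos (y : ℝ) : 0 < jb y := Real.sqrt_pos.2 (by positivity)

lemma one_le_jb (y : ℝ) : 1 ≤ jb y :=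
  Real.one_le_sqrt.2 (by nlinarith [sq_nonneg y])

lemma abs_le_jb (y : ℝ) : |y| ≤ jb y :=
  Real.abs_le_sqrt (by linarith)

lemma summable_jb_rpow_neg {a : ℝ} (ha : 1 < a) :
    Summable fun m : ℤ => jb (m : ℝ) ^ (-a) := by
  refine Summable.of_norm_bounded_eventually (Real.summable_abs_int_rpow ha) ?_
  filter_upwards [(Set.finite_singleton (0 : ℤ)).compl_mem_cofinite] with m hm
  have hm' : (m : ℝ) ≠ 0 := Int.cast_ne_zero.2 hm
  rw [Real.norm_of_nonneg (Real.rpow_nonneg (jb_pos _).le _)]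
  exact Real.rpow_le_rpow_of_nonpos (abs_pos.2 hm') (abs_le_jb _) (by linarith)

/-- A Peetre-type inequality for the Japanese bracket. -/
lemma le_two_mul_mul_jb_sub {x y : ℝ} (hx : 1 ≤ x) : y ≤ 2 * x * jb (x - y) := by
  have h1 := one_le_jb (x - y)
  have h2 := (neg_le_abs (x - y)).trans (abs_le_jb (x - y))
  nlinarith

lemma rpow_mul_jb_sub_rpow_neg_le {x y r k : ℝ} (hx : 1 ≤ x) (hy : 0 ≤ y) (hr : 0 ≤ r) :
    y ^ r * jb (x - y) ^ (-k) ≤ 2 ^ r * x ^ r * jb (x - y) ^ (-(k - r)) := by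
  have hj := jb_pos (x - y)
  calc y ^ r * jb (x - y) ^ (-k)
      ≤ (2 * x * jb (x - y)) ^ r * jb (x - y) ^ (-k) := by
        gcongr
        exact le_two_mul_mul_jb_sub hx
    _ = 2 ^ r * x ^ r * jb (x - y) ^ (-(k - r)) := by
        rw [Real.mul_rpow (by positivity) hj.le, Real.mul_rpow (by norm_num) (by linarith),
          mul_assoc, ← Real.rpow_add hj]
        ring_nf

/-- For `s ≥ 0` and `k > 2s + 1`, `Σ_{q ≥ 1} q^{2s} ⟨p−q⟩^{−k} ≤ C p^{2s}` for
every positive integer `p`.  (Stated in `ℝ≥0∞` so that the inequality also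
asserts summability of the nonnegative family.) -/
theorem stmt10 (s k : ℝ) (hs : 0 ≤ s) (hk : 2 * s + 1 < k) :
    ∃ C : ℝ, 0 < C ∧ ∀ p : ℕ+,
      ∑' q : ℕ+,
          ENNReal.ofReal ((q : ℝ) ^ (2 * s) * jb ((p : ℝ) - (q : ℝ)) ^ (-k))
        ≤ ENNReal.ofReal (C * (p : ℝ) ^ (2 * s)) := by
  have hsum : Summable fun m : ℤ => jb (m : ℝ) ^ (-(k - 2 * s)) :=
    summable_jb_rpow_neg (by linarith)
  have hnn : ∀ m : ℤ, 0 ≤ jb (m : ℝ) ^ (-(k - 2 * s)) := fun m =>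
    Real.rpow_nonneg (jb_pos _).le _
  have hpos : 0 < ∑' m : ℤ, jb (m : ℝ) ^ (-(k - 2 * s)) :=
    hsum.tsum_pos hnn 0 (Real.rpow_pos_of_pos (jb_pos _) _)
  refine ⟨2 ^ (2 * s) * ∑' m : ℤ, jb (m : ℝ) ^ (-(k - 2 * s)), by positivity, fun p => ?_⟩
  have hp : (1 : ℝ) ≤ p := by exact_mod_cast p.pos
  have hinj : Function.Injective fun q : ℕ+ => (p : ℤ) - (q : ℤ) := fun a b h => by
    have h' : (a : ℤ) = (b : ℤ) := sub_right_injective h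
    exact_mod_cast h'
  have hc : (0 : ℝ) ≤ 2 ^ (2 * s) * (p : ℝ) ^ (2 * s) := by positivity
  calc ∑' q : ℕ+, ENNReal.ofReal ((q : ℝ) ^ (2 * s) * jb ((p : ℝ) - (q : ℝ)) ^ (-k))
      ≤ ∑' q : ℕ+, ENNReal.ofReal (2 ^ (2 * s) * (p : ℝ) ^ (2 * s)) *
          ENNReal.ofReal (jb (((p : ℤ) - (q : ℤ) : ℤ) : ℝ) ^ (-(k - 2 * s))) := by
        refine ENNReal.tsum_le_tsum fun q => ?_
        rw [← ENNReal.ofReal_mul hc]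
        push_cast
        exact ENNReal.ofReal_le_ofReal
          (rpow_mul_jb_sub_rpow_neg_le hp (Nat.cast_nonneg _) (by linarith))
    _ ≤ ENNReal.ofReal (2 ^ (2 * s) * (p : ℝ) ^ (2 * s)) *
          ∑' m : ℤ, ENNReal.ofReal (jb (m : ℝ) ^ (-(k - 2 * s))) := by
        rw [ENNReal.tsum_mul_left]
        gcongr
        exact ENNReal.tsum_comp_le_tsum_of_injective hinj
          fun m : ℤ => ENNReal.ofReal (jb (m : ℝ) ^ (-(k - 2 * s)))
    _ = _ := by
        rw [← ENNReal.ofReal_tsum_of_nonneg hnn hsum, ← ENNReal.ofReal_mul hc]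
        ring_nf
end

section
/- Let n ≥ 2 be an integer, let k > 1 be real, and let s be a real number with −1 ≤ s < 0. Then there exists a constant C > 0 such that for every family of nonnegative reals (v_p)_{p ∈ (ℕ*)^n}: Σ_{q ∈ (ℕ*)^n} ( Σ_{p ∈ (ℕ*)^n} p_n · (∏_{j=1}^{n−1} ⟨p_j − q_j⟩^{−k}) · (|p|^s + |q|^s)/(|p| + |q|) · v_p )² ≤ C Σ_{p ∈ (ℕ*)^n} |p|² v_p². -/
/-- Euclidean norm of a tuple of positive integers. -/
noncomputable def en {n : ℕ} (p : Fin n → ℕ+) : ℝ := Real.sqrt (∑ j, ((p j : ℝ)) ^ 2)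

open scoped ENNReal

theorem ENNReal.tsum_prod_fin {α : Type*} : ∀ {n : ℕ} (f : Fin n → α → ℝ≥0∞),
    ∑' p : Fin n → α, ∏ j, f j (p j) = ∏ j, ∑' a, f j a
  | 0, f => by simp
  | n + 1, f => by
    rw [← (Fin.consEquiv fun _ : Fin (n + 1) => α).tsum_eq, ENNReal.tsum_prod', Fin.prod_univ_succ,
      ← ENNReal.tsum_prod_fin fun j => f j.succ, ← ENNReal.tsum_mul_right]
    simp_rw [← ENNReal.tsum_mul_left]
    simp [Fin.consEquiv, Fin.prod_univ_succ]

theorem ENNReal.sq_tsum_mul_le {ι : Type*} (f g : ι → ℝ≥0∞) :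
    (∑' i, f i * g i) ^ 2 ≤ (∑' i, f i ^ 2) * ∑' i, g i ^ 2 := by
  let _ : MeasurableSpace ι := ⊤
  have h := ENNReal.lintegral_mul_le_Lp_mul_Lq (MeasureTheory.Measure.count (α := ι))
    Real.HolderConjugate.two_two (f := f) (g := g) (measurable_from_top.aemeasurable)
    (measurable_from_top.aemeasurable)
  have hs (x : ℝ≥0∞) : (x ^ (1 / 2 : ℝ)) ^ 2 = x := by
    rw [← ENNReal.rpow_natCast, ← ENNReal.rpow_mul]; norm_num
  simp only [MeasureTheory.lintegral_count, Pi.mul_apply] at h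
  calc _ ≤ _ := pow_le_pow_left' h 2
    _ = _ := by rw [mul_pow, hs, hs]; simp

/-- Schur's test on `ℓ²` for a nonnegative kernel and a positive finite weight. -/
theorem ENNReal.tsum_sq_tsum_mul_le_of_schur {ι : Type*} (K : ι → ι → ℝ≥0∞) (h : ι → ℝ≥0∞)
    (C : ℝ≥0∞) (h0 : ∀ i, h i ≠ 0) (htop : ∀ i, h i ≠ ∞)
    (hrow : ∀ q, ∑' p, K q p * h p ≤ C * h q) (hcol : ∀ p, ∑' q, K q p * h q ≤ C * h p)
    (w : ι → ℝ≥0∞) :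
    ∑' q, (∑' p, K q p * w p) ^ 2 ≤ C ^ 2 * ∑' p, w p ^ 2 := by
  have hs (x : ℝ≥0∞) : (x ^ (1 / 2 : ℝ)) ^ 2 = x := by
    rw [← ENNReal.rpow_natCast, ← ENNReal.rpow_mul]; norm_num
  have hcs (q : ι) :
      (∑' p, K q p * w p) ^ 2 ≤ C * h q * ∑' p, K q p * (w p ^ 2 * (h p)⁻¹) := by
    have key := ENNReal.sq_tsum_mul_le (fun p => (K q p * h p) ^ (1 / 2 : ℝ))
      (fun p => (K q p * (w p ^ 2 * (h p)⁻¹)) ^ (1 / 2 : ℝ))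
    simp only [hs] at key
    refine le_trans (le_of_eq ?_) (key.trans (mul_le_mul_left (hrow q) _))
    congr 1
    refine tsum_congr fun p => ?_
    rw [← ENNReal.mul_rpow_of_nonneg _ _ (by norm_num)]
    have : K q p * h p * (K q p * (w p ^ 2 * (h p)⁻¹)) = (K q p * w p) ^ (2 : ℝ) := by
      rw [show K q p * h p * (K q p * (w p ^ 2 * (h p)⁻¹))
        = (K q p * w p) ^ 2 * (h p * (h p)⁻¹) by ring, ENNReal.mul_inv_cancel (h0 p) (htop p)]
      simp
    rw [this, ← ENNReal.rpow_mul]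
    norm_num
  calc ∑' q, (∑' p, K q p * w p) ^ 2
      ≤ ∑' q, C * h q * ∑' p, K q p * (w p ^ 2 * (h p)⁻¹) := ENNReal.tsum_le_tsum hcs
    _ = ∑' p, C * (w p ^ 2 * (h p)⁻¹) * ∑' q, K q p * h q := by
        simp_rw [← ENNReal.tsum_mul_left]
        rw [ENNReal.tsum_comm]
        exact tsum_congr fun p => tsum_congr fun q => by ring
    _ ≤ ∑' p, C ^ 2 * w p ^ 2 := ENNReal.tsum_le_tsum fun p => by
        refine (mul_le_mul_right (hcol p) _).trans (le_of_eq ?_)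
        rw [show C * (w p ^ 2 * (h p)⁻¹) * (C * h p) = C ^ 2 * w p ^ 2 * (h p * (h p)⁻¹) by ring,
          ENNReal.mul_inv_cancel (h0 p) (htop p), mul_one]
    _ = _ := ENNReal.tsum_mul_left

theorem one_div_add_mul_sqrt_le (a : ℕ) {b : ℝ} (hb : 0 < b) :
    1 / (((a + 1 : ℕ) + b) * √(a + 1 : ℕ)) ≤
      4 / √b * (√(a + 1 : ℕ) / (√(a + 1 : ℕ) + √b) - √a / (√a + √b)) := by
  have hy : 0 < √b := Real.sqrt_pos.2 hb
  have hx : 0 < √((a + 1 : ℕ) : ℝ) := Real.sqrt_pos.2 (by positivity)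
  have hz : 0 ≤ √(a : ℝ) := Real.sqrt_nonneg _
  have hzx : √(a : ℝ) ≤ √((a + 1 : ℕ) : ℝ) := Real.sqrt_le_sqrt (by push_cast; linarith)
  have hy2 := Real.sq_sqrt hb.le
  have hx2 := Real.sq_sqrt (show (0 : ℝ) ≤ (a + 1 : ℕ) by positivity)
  have hz2 := Real.sq_sqrt (show (0 : ℝ) ≤ a by positivity)
  have hxz : √((a + 1 : ℕ) : ℝ) ^ 2 - √(a : ℝ) ^ 2 = 1 := by rw [hx2, hz2]; push_cast; ring
  nth_rw 1 [← hx2]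
  nth_rw 1 [← hy2]
  generalize √((a + 1 : ℕ) : ℝ) = x at *
  generalize √(a : ℝ) = z at *
  generalize √b = y at *
  have e : 4 / y * (x / (x + y) - z / (z + y)) = 4 * (x - z) / ((x + y) * (z + y)) := by
    field_simp
    ring
  rw [e, div_le_div_iff₀ (by positivity) (by positivity)]
  have h1 : 1 ≤ 2 * x * (x - z) := by nlinarith
  have h2 : (x + y) * (z + y) ≤ 2 * (x ^ 2 + y ^ 2) := by nlinarith [sq_nonneg (x - y)]
  nlinarith [mul_le_mul_of_nonneg_right h1 (show 0 ≤ 2 * (x ^ 2 + y ^ 2) by positivity)]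

theorem tsum_one_div_add_mul_sqrt_le (b : ℕ+) :
    ∑' a : ℕ+, ENNReal.ofReal (1 / (((a : ℝ) + b) * √a)) ≤ ENNReal.ofReal (4 / √b) := by
  have hb : (0 : ℝ) < b := by exact_mod_cast b.pos
  rw [← Equiv.pnatEquivNat.symm.tsum_eq]
  refine ENNReal.tsum_le_of_sum_range_le fun N => ?_
  rw [← ENNReal.ofReal_sum_of_nonneg fun _ _ => by positivity]
  refine ENNReal.ofReal_le_ofReal ?_
  calc _ ≤ ∑ i ∈ Finset.range N,
        4 / √(b : ℝ) * (√((i + 1 : ℕ) : ℝ) / (√((i + 1 : ℕ) : ℝ) + √b) - √i / (√i + √b)) :=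
        Finset.sum_le_sum fun i _ => one_div_add_mul_sqrt_le i hb
    _ ≤ 4 / √b := by
        rw [← Finset.mul_sum, Finset.sum_range_sub fun i : ℕ => √(i : ℝ) / (√(i : ℝ) + √b)]
        have : √(N : ℝ) / (√(N : ℝ) + √b) ≤ 1 := div_le_one_of_le₀ (by simp) (by positivity)
        refine mul_le_of_le_one_right (by positivity) ?_
        simpa using this

theorem jb_neg (y : ℝ) : jb (-y) = jb y := by simp [jb]

theorem jb_rpow_nonneg (y r : ℝ) : 0 ≤ jb y ^ r := Real.rpow_nonneg (Real.sqrt_nonneg _) _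

theorem tsum_int_jb_rpow_ne_top {k : ℝ} (hk : 1 < k) :
    ∑' m : ℤ, ENNReal.ofReal (jb m ^ (-k)) ≠ ∞ := by
  have hs : Summable fun m : ℤ => jb m ^ (-k) := by
    refine Summable.of_norm_bounded_eventually (Real.summable_abs_int_rpow hk) ?_
    filter_upwards [(Set.finite_singleton (0 : ℤ)).compl_mem_cofinite] with m hm
    have hm : (m : ℝ) ≠ 0 := by exact_mod_cast hm
    have hj : |(m : ℝ)| ≤ jb m := Real.abs_le_sqrt (by linarith)
    rw [Real.norm_of_nonneg (jb_rpow_nonneg _ _)]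
    exact Real.rpow_le_rpow_of_nonpos (abs_pos.2 hm) hj (by linarith)
  rw [← ENNReal.ofReal_tsum_of_nonneg (fun m : ℤ => jb_rpow_nonneg m (-k)) hs]
  exact ENNReal.ofReal_ne_top

theorem tsum_jb_sub_rpow_le (k : ℝ) (b : ℕ+) :
    ∑' a : ℕ+, ENNReal.ofReal (jb ((a : ℝ) - b) ^ (-k)) ≤
      ∑' m : ℤ, ENNReal.ofReal (jb m ^ (-k)) := by
  have hinj : Function.Injective fun a : ℕ+ => (a : ℤ) - b := fun x y h => by
    simpa using h
  simpa using ENNReal.tsum_comp_le_tsum_of_injective hinj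
    fun m : ℤ => ENNReal.ofReal (jb m ^ (-k))

/-- The kernel dominating the commutator kernel: convolution in all directions but `l`,
Hilbert's kernel in the direction `l`. -/
noncomputable def hilbertConvKernel {n : ℕ} (l : Fin n) (k : ℝ) (q p : Fin n → ℕ+) : ℝ≥0∞ :=
  ENNReal.ofReal (1 / ((p l : ℝ) + q l)) *
    ∏ j ∈ Finset.univ.erase l, ENNReal.ofReal (jb ((p j : ℝ) - q j) ^ (-k))

theorem hilbertConvKernel_comm {n : ℕ} (l : Fin n) (k : ℝ) (q p : Fin n → ℕ+) :
    hilbertConvKernel l k q p = hilbertConvKernel l k p q := by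
  unfold hilbertConvKernel
  rw [add_comm]
  congr 1
  refine Finset.prod_congr rfl fun j _ => ?_
  rw [← jb_neg, neg_sub]

theorem tsum_hilbertConvKernel_mul_le {n : ℕ} (l : Fin n) (k : ℝ) (q : Fin n → ℕ+) :
    ∑' p, hilbertConvKernel l k q p * ENNReal.ofReal (1 / √(p l : ℝ)) ≤
      4 * (∑' m : ℤ, ENNReal.ofReal (jb m ^ (-k))) ^ (n - 1) *
        ENNReal.ofReal (1 / √(q l : ℝ)) := by
  let f : Fin n → ℕ+ → ℝ≥0∞ := fun j a =>
    if j = l then ENNReal.ofReal (1 / (((a : ℝ) + q l) * √a))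
    else ENNReal.ofReal (jb ((a : ℝ) - q j) ^ (-k))
  have hf (p : Fin n → ℕ+) :
      hilbertConvKernel l k q p * ENNReal.ofReal (1 / √(p l : ℝ)) = ∏ j, f j (p j) := by
    rw [← Finset.mul_prod_erase _ _ (Finset.mem_univ l), hilbertConvKernel, mul_right_comm,
      ← ENNReal.ofReal_mul (by positivity)]
    congr 1
    · simp [f, mul_comm]
    · exact Finset.prod_congr rfl fun j hj => by simp [f, Finset.ne_of_mem_erase hj]
  simp_rw [hf]
  rw [ENNReal.tsum_prod_fin, ← Finset.mul_prod_erase _ _ (Finset.mem_univ l), mul_right_comm]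
  refine mul_le_mul' ?_ ?_
  · have h4 : (4 : ℝ≥0∞) = ENNReal.ofReal 4 := by simp
    rw [h4, ← ENNReal.ofReal_mul (by norm_num), mul_one_div]
    simpa only [f, if_true] using tsum_one_div_add_mul_sqrt_le (q l)
  · refine (Finset.prod_le_pow_card _ _ (∑' m : ℤ, ENNReal.ofReal (jb m ^ (-k)))
      fun j hj => ?_).trans (le_of_eq ?_)
    · simpa only [f, if_neg (Finset.ne_of_mem_erase hj)] using tsum_jb_sub_rpow_le k (q j)
    · simp

theorem cast_apply_le_en {n : ℕ} (p : Fin n → ℕ+) (l : Fin n) : (p l : ℝ) ≤ en p :=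
  Real.le_sqrt_of_sq_le
    (Finset.single_le_sum (f := fun j => (p j : ℝ) ^ 2) (fun _ _ => sq_nonneg _)
      (Finset.mem_univ l))

theorem ofReal_commutator_kernel_le {n : ℕ} (l : Fin n) (k : ℝ) {s : ℝ} (hs : s < 0)
    (p q : Fin n → ℕ+) {x : ℝ} (hx : 0 ≤ x) :
    ENNReal.ofReal ((p l : ℝ) *
        (∏ j ∈ Finset.univ.erase l, jb ((p j : ℝ) - (q j : ℝ)) ^ (-k)) *
        ((en p ^ s + en q ^ s) / (en p + en q)) * x) ≤
      hilbertConvKernel l k q p * ENNReal.ofReal (2 * (en p * x)) := by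
  have hprod : 0 ≤ ∏ j ∈ Finset.univ.erase l, jb ((p j : ℝ) - (q j : ℝ)) ^ (-k) :=
    Finset.prod_nonneg fun j _ => jb_rpow_nonneg _ _
  have hone (r : Fin n → ℕ+) : (1 : ℝ) ≤ r l := by exact_mod_cast one_le (a := r l)
  have hp := cast_apply_le_en p l
  have hq := cast_apply_le_en q l
  have hp1 := Real.rpow_le_one_of_one_le_of_nonpos ((hone p).trans hp) hs.le
  have hq1 := Real.rpow_le_one_of_one_le_of_nonpos ((hone q).trans hq) hs.le
  have hpl := hone p
  have hql := hone q
  have hfrac : (en p ^ s + en q ^ s) / (en p + en q) ≤ 2 / ((p l : ℝ) + q l) :=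
    div_le_div₀ (by norm_num) (by linarith) (by linarith) (by linarith)
  have hfrac0 : 0 ≤ (en p ^ s + en q ^ s) / (en p + en q) :=
    div_nonneg (add_nonneg (Real.rpow_nonneg (by linarith) _) (Real.rpow_nonneg (by linarith) _))
      (by linarith)
  have hen : 0 ≤ en p := by linarith
  rw [hilbertConvKernel, ← ENNReal.ofReal_prod_of_nonneg fun j _ => jb_rpow_nonneg _ _,
    ← ENNReal.ofReal_mul (by positivity), ← ENNReal.ofReal_mul (by positivity)]
  refine ENNReal.ofReal_le_ofReal ?_
  calc _ ≤ en p * (∏ j ∈ Finset.univ.erase l, jb ((p j : ℝ) - (q j : ℝ)) ^ (-k)) *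
        (2 / ((p l : ℝ) + q l)) * x := by gcongr
    _ = _ := by ring

/-- Schur-type bound for the commutator contribution `A_{F₀}`, case `−1 ≤ s < 0`:
`Σ_q (Σ_p p_n ∏_{j<n} ⟨p_j−q_j⟩^{−k} (|p|^s+|q|^s)/(|p|+|q|) v_p)² ≤ C Σ_p |p|² v_p²`.
(Stated in `ℝ≥0∞` so that the inequality also asserts summability.) -/
theorem stmt17 (n : ℕ) (hn : 2 ≤ n) (k s : ℝ) (hk : 1 < k)
    (hs1 : -1 ≤ s) (hs2 : s < 0) :
    ∃ C : ℝ, 0 < C ∧ ∀ v : (Fin n → ℕ+) → ℝ, (∀ p, 0 ≤ v p) →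
      ∑' q : Fin n → ℕ+,
          (∑' p : Fin n → ℕ+,
            ENNReal.ofReal
              ((p ⟨n - 1, by omega⟩ : ℝ) *
                (∏ j ∈ Finset.univ.erase (⟨n - 1, by omega⟩ : Fin n),
                  jb ((p j : ℝ) - (q j : ℝ)) ^ (-k)) *
                ((en p ^ s + en q ^ s) / (en p + en q)) * v p)) ^ 2
        ≤ ENNReal.ofReal C *
            ∑' p : Fin n → ℕ+, ENNReal.ofReal ((∑ j, ((p j : ℝ)) ^ 2) * v p ^ 2) := by
  set l : Fin n := ⟨n - 1, by omega⟩
  set D : ℝ≥0∞ := 4 * (∑' m : ℤ, ENNReal.ofReal (jb m ^ (-k))) ^ (n - 1)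
  have hD : D ≠ ∞ := ENNReal.mul_ne_top (by simp) (ENNReal.pow_ne_top (tsum_int_jb_rpow_ne_top hk))
  have hC : D ^ 2 * 4 ≠ ∞ := ENNReal.mul_ne_top (ENNReal.pow_ne_top hD) (by simp)
  refine ⟨(D ^ 2 * 4).toReal + 1, by positivity, fun v hv => ?_⟩
  have hrow := tsum_hilbertConvKernel_mul_le l k
  calc _ ≤ ∑' q, (∑' p, hilbertConvKernel l k q p * ENNReal.ofReal (2 * (en p * v p))) ^ 2 :=
        ENNReal.tsum_le_tsum fun q => pow_le_pow_left'
          (ENNReal.tsum_le_tsum fun p => ofReal_commutator_kernel_le l k hs2 p q (hv p)) 2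
    _ ≤ D ^ 2 * ∑' p, ENNReal.ofReal (2 * (en p * v p)) ^ 2 := by
        refine ENNReal.tsum_sq_tsum_mul_le_of_schur _
          (fun p : Fin n → ℕ+ => ENNReal.ofReal (1 / √(p l : ℝ)))
          D (fun p => ?_) (fun _ => ENNReal.ofReal_ne_top) hrow (fun p => ?_) _
        · simp
        · simpa only [hilbertConvKernel_comm l k p] using hrow p
    _ = D ^ 2 * 4 * ∑' p, ENNReal.ofReal ((∑ j, ((p j : ℝ)) ^ 2) * v p ^ 2) := by
        rw [mul_assoc, ← ENNReal.tsum_mul_left (a := 4)]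
        congr 1
        refine tsum_congr fun p => ?_
        have hen0 : 0 ≤ en p := Real.sqrt_nonneg _
        have hen : en p ^ 2 = ∑ j, (p j : ℝ) ^ 2 :=
          Real.sq_sqrt (Finset.sum_nonneg fun _ _ => sq_nonneg _)
        rw [← ENNReal.ofReal_pow (mul_nonneg (by norm_num) (mul_nonneg hen0 (hv p))), ← hen,
          show (4 : ℝ≥0∞) = ENNReal.ofReal 4 by simp, ← ENNReal.ofReal_mul (by norm_num)]
        ring_nf
    _ ≤ _ := by
        gcongr
        rw [← ENNReal.ofReal_toReal hC]
        exact ENNReal.ofReal_le_ofReal (by simp)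
end
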